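/- arXiv:2604.19775 — 3 statements merged into one kernel-verified Lean document; each statement's English description precedes it below -/
import Mathlib

section
/- Marginal validity of inductive conformal anomaly detection: Let α_1, …, α_n, α_{n+1} be an exchangeable family of real-valued random variables, where α_1, …, α_n are the calibration non-conformity scores and α_{n+1} is the test score. Define the conformal p-value p = (|{j ∈ {1,…,n} : α_{n+1} ≤ α_j}| + 1)/(n + 1). Then for every significance level ε ∈ (0,1), the probability of a false alarm is bounded: P(p < ε) ≤ ε, and moreover P(p ≤ ε) ≤ ε. -/
open MeasureTheory Finset

/-- The number of coordinates of `x` that are at least `x i`. -/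
noncomputable def upRank {n : ℕ} (i : Fin (n + 1)) (x : Fin (n + 1) → ℝ) : ℕ :=
  (univ.filter fun j => x i ≤ x j).card

lemma upRank_measurable {n : ℕ} (i : Fin (n + 1)) :
    Measurable (fun x : Fin (n + 1) → ℝ => (upRank i x : ℝ)) := by
  have h : (fun x : Fin (n + 1) → ℝ => (upRank i x : ℝ)) =
      fun x => ∑ j, if x i ≤ x j then (1 : ℝ) else 0 := by
    funext x
    simp [upRank]
  rw [h]
  refine Finset.measurable_sum _ fun j _ => ?_
  exact Measurable.ite (measurableSet_le (measurable_pi_apply i) (measurable_pi_apply j))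
    measurable_const measurable_const

lemma upRank_perm {n : ℕ} (σ : Equiv.Perm (Fin (n + 1))) (i : Fin (n + 1))
    (x : Fin (n + 1) → ℝ) : upRank i (fun k => x (σ k)) = upRank (σ i) x := by
  unfold upRank
  refine Finset.card_equiv σ fun j => ?_
  simp

lemma upRank_last {n : ℕ} (x : Fin (n + 1) → ℝ) :
    upRank (Fin.last n) x =
      (univ.filter fun j : Fin n => x (Fin.last n) ≤ x j.castSucc).card + 1 := by
  unfold upRank
  rw [Finset.card_filter, Fin.sum_univ_castSucc, Finset.card_filter]
  simp

lemma card_upRank_le {n : ℕ} (x : Fin (n + 1) → ℝ) (c : ℝ) (hc : 0 ≤ c) :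
    ((univ.filter fun i => (upRank i x : ℝ) ≤ c).card : ℝ) ≤ c := by
  rcases (univ.filter fun i => (upRank i x : ℝ) ≤ c).eq_empty_or_nonempty with h | h
  · rw [h]; simpa using hc
  · obtain ⟨i, hi, hmin⟩ := Finset.exists_min_image _ x h
    refine le_trans ?_ (Finset.mem_filter.mp hi).2
    unfold upRank
    exact_mod_cast Finset.card_le_card fun j hj =>
      Finset.mem_filter.mpr ⟨Finset.mem_univ _, hmin j hj⟩

/-- **Marginal validity of inductive conformal anomaly detection.**
Let `α 0, …, α n` (indexed by `Fin (n+1)`) be an exchangeable family of real-valued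
random variables, where the first `n` of them (`α j.castSucc` for `j : Fin n`) are the
calibration non-conformity scores and `α (Fin.last n)` is the test score.  The conformal
p-value is `p ω = (#{j : Fin n | α (last) ω ≤ α j ω} + 1) / (n + 1)`.  Then for every
significance level `ε ∈ (0,1)` we have `P(p < ε) ≤ ε` and `P(p ≤ ε) ≤ ε`. -/
theorem conformal_marginal_validity
    {Ω : Type*} [MeasurableSpace Ω] (μ : Measure Ω) [IsProbabilityMeasure μ]
    (n : ℕ) (α : Fin (n + 1) → Ω → ℝ)
    (hmeas : ∀ i, Measurable (α i))
    (hexch : ∀ σ : Equiv.Perm (Fin (n + 1)),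
      Measure.map (fun ω => fun i => α (σ i) ω) μ =
        Measure.map (fun ω => fun i => α i ω) μ)
    (p : Ω → ℝ)
    (hp : ∀ ω, p ω =
      (((univ.filter fun j : Fin n => α (Fin.last n) ω ≤ α j.castSucc ω).card : ℝ) + 1)
        / (n + 1))
    (ε : ℝ) (hε : ε ∈ Set.Ioo (0 : ℝ) 1) :
    μ {ω | p ω < ε} ≤ ENNReal.ofReal ε ∧ μ {ω | p ω ≤ ε} ≤ ENNReal.ofReal ε := by
  have hn : (0 : ℝ) < n + 1 := by positivity
  set c : ℝ := ε * (n + 1) with hcdef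
  have hc : 0 ≤ c := mul_nonneg hε.1.le hn.le
  let A : Fin (n + 1) → Set Ω := fun i => {ω | (upRank i (fun k => α k ω) : ℝ) ≤ c}
  have hαm : Measurable (fun ω => fun i => α i ω) := measurable_pi_lambda _ hmeas
  have hAm : ∀ i, MeasurableSet (A i) := fun i =>
    measurableSet_le ((upRank_measurable i).comp hαm) measurable_const
  have hset : {ω | p ω ≤ ε} = A (Fin.last n) := by
    ext ω
    simp only [A, Set.mem_setOf_eq, hp, upRank_last]
    rw [div_le_iff₀ hn]
    push_cast
    rfl
  have hA : ∀ i, μ (A i) = μ (A (Fin.last n)) := by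
    intro i
    have hB : MeasurableSet {x : Fin (n + 1) → ℝ | (upRank (Fin.last n) x : ℝ) ≤ c} :=
      measurableSet_le (upRank_measurable _) measurable_const
    have h := congrArg (fun ν => ν {x : Fin (n + 1) → ℝ | (upRank (Fin.last n) x : ℝ) ≤ c})
      (hexch (Equiv.swap (Fin.last n) i))
    rw [Measure.map_apply (measurable_pi_lambda _ fun k => hmeas _) hB,
      Measure.map_apply hαm hB] at h
    have e : (fun ω => fun k => α ((Equiv.swap (Fin.last n) i) k) ω) ⁻¹'
        {x : Fin (n + 1) → ℝ | (upRank (Fin.last n) x : ℝ) ≤ c} = A i := by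
      ext ω
      have := upRank_perm (Equiv.swap (Fin.last n) i) (Fin.last n) (fun k => α k ω)
      simp only [Equiv.swap_apply_left] at this
      simp only [A, Set.mem_preimage, Set.mem_setOf_eq, this]
    rw [e] at h
    exact h
  have hsum : ∑ i, μ (A i) ≤ ENNReal.ofReal c := by
    calc ∑ i, μ (A i) = ∑ i, ∫⁻ ω, (A i).indicator 1 ω ∂μ := by
          simp_rw [lintegral_indicator_one (hAm _)]
      _ = ∫⁻ ω, ∑ i, (A i).indicator 1 ω ∂μ :=
          (lintegral_finsetSum _ fun i _ => measurable_one.indicator (hAm i)).symm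
      _ ≤ ∫⁻ _, ENNReal.ofReal c ∂μ := by
          refine lintegral_mono fun ω => ?_
          have h := card_upRank_le (fun k => α k ω) c hc
          have e : ∑ i, (A i).indicator (1 : Ω → ENNReal) ω =
              ((univ.filter fun i => (upRank i (fun k => α k ω) : ℝ) ≤ c).card : ENNReal) := by
            simp [Set.indicator_apply, A]
          simp only [e]
          rw [← ENNReal.ofReal_natCast]
          exact ENNReal.ofReal_le_ofReal h
      _ = ENNReal.ofReal c := by simp
  have main : μ {ω | p ω ≤ ε} ≤ ENNReal.ofReal ε := by
    rw [hset]
    simp_rw [hA] at hsum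
    rw [Finset.sum_const, Finset.card_univ, Fintype.card_fin, nsmul_eq_mul, hcdef,
      ENNReal.ofReal_mul hε.1.le, mul_comm] at hsum
    have e : ENNReal.ofReal ((n : ℝ) + 1) = ((n + 1 : ℕ) : ENNReal) := by
      rw [← ENNReal.ofReal_natCast]; push_cast; rfl
    rw [e] at hsum
    exact (ENNReal.mul_le_mul_iff_left (by simp) (ENNReal.natCast_ne_top _)).mp hsum
  exact ⟨(measure_mono fun ω (h : p ω < ε) => h.le).trans main, main⟩
end

section
/- Deterministic rank-counting lemma underlying conformal validity: Let α_1, …, α_{n+1} be any real numbers. For each index k ∈ {1,…,n+1}, define the leave-one-out p-value p_k = (|{j ∈ {1,…,n+1}, j ≠ k : α_k ≤ α_j}| + 1)/(n + 1). Then for every ε ∈ (0,1), the number of indices k with p_k ≤ ε is at most ⌊ε(n+1)⌋; in particular, at most an ε-fraction of the n+1 values can receive a p-value at most ε. -/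
open Finset

/-- **Deterministic rank-counting lemma underlying conformal validity.**
Let `α 1, …, α (n+1)` (indexed by `Fin (n+1)`) be any real numbers, and for each
index `k` define the leave-one-out p-value
`p k = (#{j ≠ k | α k ≤ α j} + 1)/(n+1)`.  Then for every `ε ∈ (0,1)`, the number of
indices `k` with `p k ≤ ε` is at most `⌊ε (n+1)⌋`: at most an `ε`-fraction of the
`n+1` values can receive a p-value at most `ε`. -/
theorem conformal_rank_counting
    (n : ℕ) (α : Fin (n + 1) → ℝ)
    (p : Fin (n + 1) → ℝ)
    (hp : ∀ k, p k =
      (((univ.filter fun j : Fin (n + 1) => j ≠ k ∧ α k ≤ α j).card : ℝ) + 1) / (n + 1))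
    (ε : ℝ) (hε : ε ∈ Set.Ioo (0 : ℝ) 1) :
    (((univ.filter fun k : Fin (n + 1) => p k ≤ ε).card : ℤ)) ≤ ⌊ε * (n + 1)⌋ := by
  have hn : (0 : ℝ) < (n : ℝ) + 1 := by positivity
  rw [Int.le_floor]
  rcases (univ.filter fun k : Fin (n + 1) => p k ≤ ε).eq_empty_or_nonempty with h | h
  · rw [h]
    have := mul_pos hε.1 hn
    simpa using this.le
  · obtain ⟨k, hk, hmin⟩ := exists_min_image _ α h
    have hkε : p k ≤ ε := (mem_filter.mp hk).2
    rw [hp k, div_le_iff₀ hn] at hkε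
    have hsub : (univ.filter fun k : Fin (n + 1) => p k ≤ ε) ⊆
        insert k (univ.filter fun j : Fin (n + 1) => j ≠ k ∧ α k ≤ α j) := by
      intro j hj
      by_cases hjk : j = k
      · exact mem_insert.mpr (Or.inl hjk)
      · exact mem_insert.mpr (Or.inr (mem_filter.mpr ⟨mem_univ _, hjk, hmin j hj⟩))
    have hcard := (card_le_card hsub).trans (card_insert_le _ _)
    refine le_trans ?_ hkε
    exact_mod_cast hcard
end

section
/- Discrete uniformity of the conformal p-value under almost-sure distinctness: Let α_1, …, α_n, α_{n+1} be an exchangeable family of real-valued random variables such that almost surely all n+1 values are pairwise distinct, and define the conformal p-value p = (|{j ∈ {1,…,n} : α_{n+1} ≤ α_j}| + 1)/(n + 1). Then p is uniformly distributed on the set {1/(n+1), 2/(n+1), …, 1}; in particular, for every ε ∈ (0,1), P(p ≤ ε) = ⌊ε(n+1)⌋/(n+1), so that ε − 1/(n+1) < P(p ≤ ε) ≤ ε. -/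
open MeasureTheory Finset
open scoped ENNReal

/-- Number of coordinates that are at least the `i`-th one. -/
noncomputable def rankGE {m : ℕ} (x : Fin m → ℝ) (i : Fin m) : ℕ :=
  ∑ j : Fin m, if x i ≤ x j then 1 else 0

lemma rankGE_eq_card {m : ℕ} (x : Fin m → ℝ) (i : Fin m) :
    rankGE x i = (univ.filter fun j => x i ≤ x j).card := by
  rw [rankGE, Finset.card_filter]

lemma measurable_rankGE {m : ℕ} (i : Fin m) :
    Measurable (fun x : Fin m → ℝ => rankGE x i) := by
  unfold rankGE
  refine Finset.measurable_sum _ fun j _ => ?_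
  exact Measurable.ite (measurableSet_le (measurable_pi_apply i) (measurable_pi_apply j))
    measurable_const measurable_const

lemma rankGE_perm {m : ℕ} (x : Fin m → ℝ) (σ : Equiv.Perm (Fin m)) (i : Fin m) :
    rankGE (fun j => x (σ j)) i = rankGE x (σ i) := by
  unfold rankGE
  exact Equiv.sum_comp σ (fun j => if x (σ i) ≤ x j then 1 else 0)

lemma rankGE_pos {m : ℕ} (x : Fin m → ℝ) (i : Fin m) : 1 ≤ rankGE x i := by
  rw [rankGE_eq_card]
  exact Finset.card_pos.mpr ⟨i, by simp⟩

lemma rankGE_le {m : ℕ} (x : Fin m → ℝ) (i : Fin m) : rankGE x i ≤ m := by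
  rw [rankGE_eq_card]
  exact (Finset.card_le_univ _).trans (by simp)

lemma rankGE_lt {m : ℕ} (x : Fin m → ℝ) {i j : Fin m} (h : x i < x j) :
    rankGE x j < rankGE x i := by
  rw [rankGE_eq_card, rankGE_eq_card]
  apply Finset.card_lt_card
  rw [Finset.ssubset_iff_of_subset]
  · exact ⟨i, by simp, by simpa using h⟩
  · intro k hk
    simp only [mem_filter, mem_univ, true_and] at hk ⊢
    linarith

lemma rankGE_card {m : ℕ} (x : Fin m → ℝ) (hx : ∀ i j, i ≠ j → x i ≠ x j) (k : ℕ)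
    (h1 : 1 ≤ k) (h2 : k ≤ m) : ∑ i : Fin m, (if rankGE x i = k then (1 : ℝ≥0∞) else 0) = 1 := by
  have hinj : Function.Injective (rankGE x) := by
    intro i j hij
    by_contra hne
    rcases lt_or_gt_of_ne (hx i j hne) with h | h
    · have := rankGE_lt x h; omega
    · have := rankGE_lt x h; omega
  have himg : univ.image (rankGE x) = Finset.Icc 1 m := by
    apply Finset.eq_of_subset_of_card_le
    · intro a ha
      obtain ⟨i, -, rfl⟩ := Finset.mem_image.mp ha
      exact Finset.mem_Icc.mpr ⟨rankGE_pos x i, rankGE_le x i⟩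
    · rw [Finset.card_image_of_injective _ hinj]; simp
  have hk : k ∈ univ.image (rankGE x) := by rw [himg]; exact Finset.mem_Icc.mpr ⟨h1, h2⟩
  obtain ⟨i, -, rfl⟩ := Finset.mem_image.mp hk
  simp [hinj.eq_iff]

lemma rank_uniform {Ω : Type*} [MeasurableSpace Ω] (μ : Measure Ω) [IsProbabilityMeasure μ]
    (n : ℕ) (α : Fin (n + 1) → Ω → ℝ)
    (hmeas : ∀ i, Measurable (α i))
    (hexch : ∀ σ : Equiv.Perm (Fin (n + 1)),
      Measure.map (fun ω => fun i => α (σ i) ω) μ =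
        Measure.map (fun ω => fun i => α i ω) μ)
    (hdistinct : ∀ᵐ ω ∂μ, ∀ i j : Fin (n + 1), i ≠ j → α i ω ≠ α j ω)
    (k : ℕ) (h1 : 1 ≤ k) (h2 : k ≤ n + 1) :
    μ {ω | rankGE (fun i => α i ω) (Fin.last n) = k} = 1 / ((n : ℝ≥0∞) + 1) := by
  have hm : Measurable (fun ω => fun i => α i ω) := measurable_pi_lambda _ hmeas
  have hS : ∀ i : Fin (n + 1), MeasurableSet {x : Fin (n + 1) → ℝ | rankGE x i = k} := fun i =>
    measurable_rankGE i (measurableSet_singleton k)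
  have hE : ∀ i : Fin (n + 1), MeasurableSet {ω | rankGE (fun i => α i ω) i = k} := fun i =>
    hm (hS i)
  have heq : ∀ i : Fin (n + 1), μ {ω | rankGE (fun i => α i ω) i = k} =
      μ {ω | rankGE (fun i => α i ω) (Fin.last n) = k} := by
    intro i
    have h := congrArg (fun ν => ν {x : Fin (n + 1) → ℝ | rankGE x (Fin.last n) = k})
      (hexch (Equiv.swap i (Fin.last n)))
    rw [Measure.map_apply (measurable_pi_lambda _ fun j => hmeas _) (hS _),
      Measure.map_apply hm (hS _)] at h
    simp only [Set.preimage_setOf_eq] at h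
    rw [← h]
    congr 1
    ext ω
    have := rankGE_perm (fun i => α i ω) (Equiv.swap i (Fin.last n)) (Fin.last n)
    simp only [Equiv.swap_apply_right] at this
    simp only [Set.mem_ofPred_eq, this]
  have hsum : ∑ i : Fin (n + 1), μ {ω | rankGE (fun i => α i ω) i = k} = 1 := by
    calc _ = ∑ i : Fin (n + 1), ∫⁻ ω, (if rankGE (fun i => α i ω) i = k then 1 else 0) ∂μ := by
          refine Finset.sum_congr rfl fun i _ => ?_
          rw [← lintegral_indicator_one (hE i)]
          refine lintegral_congr fun ω => ?_
          simp [Set.indicator_apply]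
      _ = ∫⁻ ω, ∑ i : Fin (n + 1), (if rankGE (fun i => α i ω) i = k then 1 else 0) ∂μ := by
          rw [lintegral_finsetSum]
          intro i _
          exact Measurable.ite (hE i) measurable_const measurable_const
      _ = ∫⁻ ω, 1 ∂μ := by
          refine lintegral_congr_ae ?_
          filter_upwards [hdistinct] with ω hω
          exact rankGE_card _ hω k h1 h2
      _ = 1 := by simp
  simp only [heq, Finset.sum_const, Finset.card_univ, Fintype.card_fin, nsmul_eq_mul] at hsum
  rw [ENNReal.eq_div_iff (by simp) (by finiteness)]
  exact_mod_cast hsum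

/-- **Discrete uniformity of the conformal p-value under almost-sure distinctness.**
Let `α 0, …, α n` (indexed by `Fin (n+1)`, calibration scores `α j.castSucc` and test
score `α (Fin.last n)`) be an exchangeable family of real-valued random variables that
are almost surely pairwise distinct, and let
`p ω = (#{j : Fin n | α (last) ω ≤ α j ω} + 1)/(n+1)` be the conformal p-value.
Then `p` is uniform on `{1/(n+1), …, (n+1)/(n+1)}`: each such value has probability
`1/(n+1)`; and for every `ε ∈ (0,1)`, `P(p ≤ ε) = ⌊ε(n+1)⌋/(n+1)`, whence
`ε − 1/(n+1) < P(p ≤ ε) ≤ ε`. -/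
theorem conformal_p_value_discrete_uniform
    {Ω : Type*} [MeasurableSpace Ω] (μ : Measure Ω) [IsProbabilityMeasure μ]
    (n : ℕ) (α : Fin (n + 1) → Ω → ℝ)
    (hmeas : ∀ i, Measurable (α i))
    (hexch : ∀ σ : Equiv.Perm (Fin (n + 1)),
      Measure.map (fun ω => fun i => α (σ i) ω) μ =
        Measure.map (fun ω => fun i => α i ω) μ)
    (hdistinct : ∀ᵐ ω ∂μ, ∀ i j : Fin (n + 1), i ≠ j → α i ω ≠ α j ω)
    (p : Ω → ℝ)
    (hp : ∀ ω, p ω =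
      (((univ.filter fun j : Fin n => α (Fin.last n) ω ≤ α j.castSucc ω).card : ℝ) + 1)
        / (n + 1)) :
    (∀ k : ℕ, 1 ≤ k → k ≤ n + 1 →
        μ {ω | p ω = (k : ℝ) / (n + 1)} = 1 / ((n : ℝ≥0∞) + 1)) ∧
      ∀ ε : ℝ, ε ∈ Set.Ioo (0 : ℝ) 1 →
        μ {ω | p ω ≤ ε} = ENNReal.ofReal ((⌊ε * (n + 1)⌋ : ℝ) / (n + 1)) ∧
          ε - 1 / (n + 1) < (μ {ω | p ω ≤ ε}).toReal ∧
          (μ {ω | p ω ≤ ε}).toReal ≤ ε := by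
  have hpos : (0 : ℝ) < (n : ℝ) + 1 := by positivity
  have hpr : ∀ ω, p ω = (rankGE (fun i => α i ω) (Fin.last n) : ℝ) / (n + 1) := by
    intro ω
    rw [hp, rankGE, Fin.sum_univ_castSucc, Finset.card_filter]
    simp
  have hU := rank_uniform μ n α hmeas hexch hdistinct
  have hm : Measurable (fun ω => fun i => α i ω) := measurable_pi_lambda _ hmeas
  refine ⟨fun k h1 h2 => ?_, fun ε hε => ?_⟩
  · rw [← hU k h1 h2]
    congr 1
    ext ω
    simp only [Set.mem_ofPred_eq, hpr]
    rw [div_left_inj' hpos.ne', Nat.cast_inj]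
  · obtain ⟨h0, h1⟩ := hε
    have hx0 : 0 ≤ ε * ((n : ℝ) + 1) := by positivity
    obtain ⟨m, hmdef⟩ : ∃ m, m = ⌊ε * ((n : ℝ) + 1)⌋₊ := ⟨_, rfl⟩
    have hfl : ((⌊ε * ((n : ℝ) + 1)⌋ : ℤ) : ℝ) = (m : ℝ) := by
      rw [hmdef, natCast_floor_eq_intCast_floor hx0]
    have hle : (m : ℝ) ≤ ε * (n + 1) := by rw [hmdef]; exact Nat.floor_le hx0
    have hlt : ε * (n + 1) < (m : ℝ) + 1 := by rw [hmdef]; exact Nat.lt_floor_add_one _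
    have hmn : m ≤ n + 1 := by
      have : (m : ℝ) ≤ ((n + 1 : ℕ) : ℝ) := by push_cast; nlinarith
      exact_mod_cast this
    have hset : {ω | p ω ≤ ε} =
        ⋃ k ∈ Finset.Icc 1 m, {ω | rankGE (fun i => α i ω) (Fin.last n) = k} := by
      ext ω
      simp only [Set.mem_ofPred_eq, hpr, Set.mem_iUnion, exists_prop, exists_eq_right',
        Finset.mem_Icc]
      rw [div_le_iff₀ hpos, ← Nat.le_floor_iff hx0, ← hmdef]
      exact ⟨fun h => ⟨rankGE_pos _ _, h⟩, fun h => h.2⟩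
    have hval : μ {ω | p ω ≤ ε} = ENNReal.ofReal ((m : ℝ) / (n + 1)) := by
      rw [hset, measure_biUnion_finset]
      · rw [Finset.sum_congr rfl fun k hk => hU k (Finset.mem_Icc.mp hk).1
          ((Finset.mem_Icc.mp hk).2.trans hmn)]
        rw [ENNReal.ofReal_div_of_pos hpos, ENNReal.ofReal_add (by positivity) (by positivity)]
        simp [div_eq_mul_inv]
      · intro a _ b _ hab
        rw [Function.onFun, Set.disjoint_left]
        intro ω ha hb
        exact hab (ha.symm.trans hb)
      · intro k _
        exact hm (measurable_rankGE (Fin.last n) (measurableSet_singleton k))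
    refine ⟨by rw [hval, hfl], ?_, ?_⟩
    · rw [hval, ENNReal.toReal_ofReal (by positivity), sub_lt_iff_lt_add, ← add_div,
        lt_div_iff₀ hpos]
      exact hlt
    · rw [hval, ENNReal.toReal_ofReal (by positivity), div_le_iff₀ hpos]
      exact hle
end
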